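/- arXiv:0902.3762 — 2 statements merged into one kernel-verified Lean document; each statement's English description precedes it below -/
import Mathlib

section
/- Let p be prime and T_{f[l,r]} the invertible right permutative linear CA over Z_{p²} with local rule f(x_l,...,x_r) = p·Σ_{i=l}^{r-1} β_i x_i + λ_r x_r (mod p²), gcd(p, λ_r) = 1, 0 < l < r. For every i ≥ 0 the partition ξ(-i,i) = ⋁_{u=-i}^{i} σ^{-u} ξ (where ξ is the zero-time partition by the value of coordinate 0) is weakly Bernoulli for T_{f[l,r]}: for every ε > 0 there exists N > 0 such that ⋁_{k=-n}^{0} T^k ξ(-i,i) and ⋁_{k=N}^{N+n} T^k ξ(-i,i) are ε-independent for all n ≥ 0. -/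
open MeasureTheory
open scoped ENNReal

instance (m : ℕ) : MeasurableSpace (ZMod m) := ⊤

/-- Events depending on adjacent blocks of coordinates are independent. -/
theorem indep_blocks (q : ℕ) [NeZero q] (μ : Measure (ℤ → ZMod q)) [IsProbabilityMeasure μ]
    (hμ : ∀ (a : ℤ) (s : ℕ) (j : ℕ → ZMod q),
      μ {x | ∀ t : ℕ, t ≤ s → x (a + (t : ℤ)) = j t} = ((q : ℝ≥0∞))⁻¹ ^ (s + 1))
    (a : ℤ) (s s' : ℕ) (D C : Set (ℤ → ZMod q))
    (hD : ∀ x y : ℤ → ZMod q, (∀ v, a ≤ v → v ≤ a + s → x v = y v) → x ∈ D → y ∈ D)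
    (hC : ∀ x y : ℤ → ZMod q,
      (∀ v, a + s + 1 ≤ v → v ≤ a + s + 1 + s' → x v = y v) → x ∈ C → y ∈ C) :
    μ (C ∩ D) = μ C * μ D := by
  haveI : DiscreteMeasurableSpace (ZMod q) := ⟨fun _ => trivial⟩
  let X : (ℤ → ZMod q) → (Fin (s + 1) → ZMod q) := fun x t => x (a + ((t : ℕ) : ℤ))
  let Y : (ℤ → ZMod q) → (Fin (s' + 1) → ZMod q) := fun x t => x (a + s + 1 + ((t : ℕ) : ℤ))
  have hX : Measurable X := by
    apply measurable_pi_lambda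
    intro t
    exact measurable_pi_apply _
  have hY : Measurable Y := by
    apply measurable_pi_lambda
    intro t
    exact measurable_pi_apply _
  have hXs : ∀ w, μ (X ⁻¹' {w}) = ((q : ℝ≥0∞))⁻¹ ^ (s + 1) := by
    intro w
    rw [← hμ a s (fun t => if h : t < s + 1 then w ⟨t, h⟩ else 0)]
    congr 1
    ext x
    simp only [Set.mem_preimage, Set.mem_singleton_iff, Set.mem_setOf_eq, funext_iff, X]
    constructor
    · intro h t ht
      rw [dif_pos (by omega)]
      exact h ⟨t, by omega⟩
    · intro h t
      have := h t (by omega)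
      rw [dif_pos t.2] at this
      exact this
  have hYs : ∀ w, μ (Y ⁻¹' {w}) = ((q : ℝ≥0∞))⁻¹ ^ (s' + 1) := by
    intro w
    rw [← hμ (a + s + 1) s' (fun t => if h : t < s' + 1 then w ⟨t, h⟩ else 0)]
    congr 1
    ext x
    simp only [Set.mem_preimage, Set.mem_singleton_iff, Set.mem_setOf_eq, funext_iff, Y]
    constructor
    · intro h t ht
      rw [dif_pos (by omega)]
      exact h ⟨t, by omega⟩
    · intro h t
      have := h t (by omega)
      rw [dif_pos t.2] at this
      exact this
  have hXY : ∀ w w', μ (X ⁻¹' {w} ∩ Y ⁻¹' {w'}) = ((q : ℝ≥0∞))⁻¹ ^ (s + 1 + (s' + 1)) := by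
    intro w w'
    have e := hμ a (s + 1 + s') (fun t => if h : t < s + 1 then w ⟨t, h⟩ else
      if h' : t - (s + 1) < s' + 1 then w' ⟨t - (s + 1), h'⟩ else 0)
    rw [show s + 1 + (s' + 1) = s + 1 + s' + 1 by ring, ← e]
    congr 1
    ext x
    simp only [Set.mem_inter_iff, Set.mem_preimage, Set.mem_singleton_iff, Set.mem_setOf_eq,
      funext_iff, X, Y]
    constructor
    · rintro ⟨h, h'⟩ t ht
      by_cases h1 : t < s + 1
      · rw [dif_pos h1]
        exact h ⟨t, h1⟩
      · rw [dif_neg h1, dif_pos (by omega), ← h' ⟨t - (s + 1), by omega⟩]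
        congr 1
        simp only
        omega
    · intro h
      constructor
      · intro t
        have := h t (by omega)
        rw [dif_pos t.2] at this
        exact this
      · intro t
        have := h (s + 1 + t) (by omega)
        rw [dif_neg (by omega), dif_pos (by omega)] at this
        have e1 : (⟨s + 1 + (t : ℕ) - (s + 1), by omega⟩ : Fin (s' + 1)) = t := by
          ext
          simp only
          omega
        rw [e1] at this
        rw [← this]
        congr 1
        push_cast
        ring
  have hind : ProbabilityTheory.IndepFun X Y μ := by
    rw [ProbabilityTheory.indepFun_iff_map_prod_eq_prod_map_map hX.aemeasurable hY.aemeasurable]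
    apply Measure.ext_of_singleton
    rintro ⟨w, w'⟩
    rw [Measure.map_apply (hX.prodMk hY) (measurableSet_singleton _), ← Set.singleton_prod_singleton,
      Measure.prod_prod, Measure.map_apply hX (measurableSet_singleton _),
      Measure.map_apply hY (measurableSet_singleton _), Set.mk_preimage_prod, hXs, hYs, hXY, pow_add]
  have eD : D = X ⁻¹' (X '' D) := by
    apply Set.Subset.antisymm (Set.subset_preimage_image _ _)
    rintro y ⟨x, hx, hxy⟩
    refine hD x y ?_ hx
    intro v h1 h2
    have := congrFun hxy ⟨(v - a).toNat, by omega⟩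
    simp only [X] at this
    rwa [show a + (((v - a).toNat : ℕ) : ℤ) = v by omega] at this
  have eC : C = Y ⁻¹' (Y '' C) := by
    apply Set.Subset.antisymm (Set.subset_preimage_image _ _)
    rintro y ⟨x, hx, hxy⟩
    refine hC x y ?_ hx
    intro v h1 h2
    have := congrFun hxy ⟨(v - (a + s + 1)).toNat, by omega⟩
    simp only [Y] at this
    rwa [show a + s + 1 + (((v - (a + s + 1)).toNat : ℕ) : ℤ) = v by omega] at this
  rw [eD, eC, Set.inter_comm, mul_comm]
  exact hind.measure_inter_preimage_eq_mul _ _ (Set.toFinite _).measurableSet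
    (Set.toFinite _).measurableSet

/-- Locality of the forward CA. -/
theorem T_local (q : ℕ) (P : ZMod q) (l r : ℤ) (hl : 0 < l) (hlr : l < r)
    (β : ℤ → ZMod q) (lamr : ZMod q)
    (T : (ℤ → ZMod q) → ℤ → ZMod q)
    (hT : ∀ x n, T x n =
      P * ∑ i ∈ Finset.Icc l (r - 1), β i * x (n + i) + lamr * x (n + r))
    (a : ℤ) (k : ℕ) : ∀ (b : ℤ) (x y : ℤ → ZMod q),
      (∀ v, a ≤ v → v ≤ b + k * r → x v = y v) →
      ∀ v, a ≤ v → v ≤ b → T^[k] x v = T^[k] y v := by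
  induction k with
  | zero =>
    intro b x y h v h1 h2
    exact h v h1 (by simpa using h2)
  | succ k ih =>
    intro b x y h v h1 h2
    rw [Function.iterate_succ_apply, Function.iterate_succ_apply]
    refine ih b (T x) (T y) ?_ v h1 h2
    intro w h3 h4
    have hb : b + ((k + 1 : ℕ) : ℤ) * r = b + k * r + r := by push_cast; ring
    rw [hb] at h
    rw [hT, hT, h (w + r) (by omega) (by omega)]
    congr 2
    apply Finset.sum_congr rfl
    intro j hj
    rw [Finset.mem_Icc] at hj
    rw [h (w + j) (by omega) (by omega)]

/-- Locality of the inverse CA. -/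
theorem S_local (q : ℕ) (P : ZMod q) (hP : P * P = 0) (l r : ℤ) (hl : 0 < l) (hlr : l < r)
    (β : ℤ → ZMod q) (lamr : ZMod q) (hunit : IsUnit lamr)
    (T S : (ℤ → ZMod q) → ℤ → ZMod q)
    (hT : ∀ x n, T x n =
      P * ∑ i ∈ Finset.Icc l (r - 1), β i * x (n + i) + lamr * x (n + r))
    (hTS : ∀ x, T (S x) = x)
    (k : ℕ) : ∀ (a b : ℤ) (x y : ℤ → ZMod q),
      (∀ v, a ≤ v → v ≤ b → x v = y v) →
      ∀ v, a + 2 * (k * r) ≤ v → v ≤ b + k * r → S^[k] x v = S^[k] y v := by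
  have step : ∀ (a b : ℤ) (x y : ℤ → ZMod q), (∀ v, a ≤ v → v ≤ b → x v = y v) →
      ∀ v, a + 2 * r ≤ v → v ≤ b + r → S x v = S y v := by
    intro a b x y h
    have e : ∀ n, a ≤ n → n ≤ b →
        P * ∑ i ∈ Finset.Icc l (r - 1), β i * (S x (n + i) - S y (n + i)) +
          lamr * (S x (n + r) - S y (n + r)) = 0 := by
      intro n h1 h2
      have e1 := hT (S x) n
      have e2 := hT (S y) n
      rw [hTS] at e1 e2
      have e3 := h n h1 h2
      rw [e1, e2] at e3
      simp only [mul_sub, Finset.sum_sub_distrib]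
      linear_combination e3
    have e2 : ∀ w, a + r ≤ w → w ≤ b + r → P * (S x w - S y w) = 0 := by
      intro w h1 h2
      have := e (w - r) (by omega) (by omega)
      rw [show w - r + r = w by ring] at this
      apply hunit.mul_left_cancel
      rw [mul_zero]
      linear_combination P * this - (∑ i ∈ Finset.Icc l (r - 1),
        β i * (S x (w - r + i) - S y (w - r + i))) * hP
    intro v h1 h2
    have h3 := e (v - r) (by omega) (by omega)
    rw [show v - r + r = v by ring, Finset.mul_sum, Finset.sum_eq_zero, zero_add] at h3
    · apply sub_eq_zero.mp
      apply hunit.mul_left_cancel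
      rw [h3, mul_zero]
    · intro j hj
      rw [Finset.mem_Icc] at hj
      linear_combination β j * e2 (v - r + j) (by omega) (by omega)
  induction k with
  | zero =>
    intro a b x y h v h1 h2
    exact h v (by simpa using h1) (by simpa using h2)
  | succ k ih =>
    intro a b x y h v h1 h2
    rw [Function.iterate_succ_apply, Function.iterate_succ_apply]
    have hb : ((k + 1 : ℕ) : ℤ) * r = k * r + r := by push_cast; ring
    rw [hb] at h1 h2
    exact ih (a + 2 * r) (b + r) (S x) (S y) (step a b x y h) v (by linarith) (by linarith)


/-- Let `p` be prime and `T = T_{f[l,r]}` the invertible right permutative linear CA over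
`ZMod p²` with local rule `f(x_l,...,x_r) = p·Σ_{i=l}^{r-1} β_i x_i + λ_r x_r (mod p²)`,
`λ_r` a unit, `0 < l < r`, with inverse CA `S`. For every `i ≥ 0` the partition
`ξ(-i,i) = ⋁_{u=-i}^{i} σ^{-u} ξ` (by the coordinates in `[-i,i]`) is weakly Bernoulli for
`T`: for every `ε > 0` there is `N > 0` such that for all `n ≥ 0` the partitions
`⋁_{k=-n}^{0} T^k ξ(-i,i)` (with atoms `{x | (T^k x)_u = c(k,u)}`) and
`⋁_{k=N}^{N+n} T^k ξ(-i,i)` (with atoms `{x | (S^{N+k} x)_u = d(k,u)}`) are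
`ε`-independent: `Σ_{c,d} |μ(C_c ∩ D_d) − μ(C_c)μ(D_d)| ≤ ε`. -/
theorem stmt16 (p : ℕ) (hp : p.Prime) [NeZero p] (l r : ℤ) (hl : 0 < l) (hlr : l < r)
    (β : ℤ → ZMod (p ^ 2)) (lamr : ZMod (p ^ 2)) (hunit : IsUnit lamr)
    (T S : (ℤ → ZMod (p ^ 2)) → ℤ → ZMod (p ^ 2))
    (hT : ∀ x n, T x n =
      (p : ZMod (p ^ 2)) * ∑ i ∈ Finset.Icc l (r - 1), β i * x (n + i) + lamr * x (n + r))
    (hST : ∀ x, S (T x) = x) (hTS : ∀ x, T (S x) = x)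
    (μ : Measure (ℤ → ZMod (p ^ 2))) [IsProbabilityMeasure μ]
    (hμ : ∀ (a : ℤ) (s : ℕ) (j : ℕ → ZMod (p ^ 2)),
      μ {x | ∀ t : ℕ, t ≤ s → x (a + (t : ℤ)) = j t} = (((p ^ 2 : ℕ) : ℝ≥0∞))⁻¹ ^ (s + 1))
    (i : ℕ) :
    ∀ ε : ℝ, 0 < ε → ∃ N : ℕ, 0 < N ∧ ∀ n : ℕ,
      ∑ c : Fin (n + 1) × (Finset.Icc (-(i : ℤ)) (i : ℤ)) → ZMod (p ^ 2),
        ∑ d : Fin (n + 1) × (Finset.Icc (-(i : ℤ)) (i : ℤ)) → ZMod (p ^ 2),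
          |(μ ({x | ∀ (k : Fin (n + 1)) (u : Finset.Icc (-(i : ℤ)) (i : ℤ)),
                  T^[(k : ℕ)] x (u : ℤ) = c (k, u)} ∩
                {x | ∀ (k : Fin (n + 1)) (u : Finset.Icc (-(i : ℤ)) (i : ℤ)),
                  S^[N + (k : ℕ)] x (u : ℤ) = d (k, u)})).toReal -
            (μ {x | ∀ (k : Fin (n + 1)) (u : Finset.Icc (-(i : ℤ)) (i : ℤ)),
                  T^[(k : ℕ)] x (u : ℤ) = c (k, u)}).toReal *
            (μ {x | ∀ (k : Fin (n + 1)) (u : Finset.Icc (-(i : ℤ)) (i : ℤ)),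
                  S^[N + (k : ℕ)] x (u : ℤ) = d (k, u)}).toReal| ≤ ε := by
  intro ε hε
  refine ⟨2 * i + 1, by omega, ?_⟩
  intro n
  have hP : (p : ZMod (p ^ 2)) * (p : ZMod (p ^ 2)) = 0 := by
    rw [← Nat.cast_mul, ← sq]
    exact ZMod.natCast_self _
  refine le_trans (le_of_eq ?_) hε.le
  apply Finset.sum_eq_zero
  intro c _
  apply Finset.sum_eq_zero
  intro d _
  rw [abs_eq_zero, sub_eq_zero, ← ENNReal.toReal_mul]
  congr 1
  have hr : 0 < r := by omega
  obtain ⟨R, rfl⟩ := Int.eq_ofNat_of_zero_le hr.le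
  refine indep_blocks (p ^ 2) μ hμ (-(i : ℤ) - 1 - (2 * ((2 * i + 1 + n) * R) : ℕ))
    (2 * ((2 * i + 1 + n) * R)) (2 * i + n * R) _ _ ?_ ?_
  · intro x y hxy hx k u
    rw [← hx k u]
    have hu := Finset.mem_Icc.mp u.2
    have hk : (k : ℕ) ≤ n := by omega
    have b1 : ((2 * i + 1 + (k : ℕ)) * R) ≤ ((2 * i + 1 + n) * R) :=
      Nat.mul_le_mul_right _ (by omega)
    have b2 : 2 * i + 1 ≤ ((2 * i + 1 + (k : ℕ)) * R) := by
      have : 1 ≤ R := by omega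
      nlinarith
    symm
    refine S_local _ _ hP l R hl hlr β lamr hunit T S hT hTS _ _ _ x y hxy u ?_ ?_
    · zify at b1 b2
      push_cast
      linarith [hu.1]
    · zify at b1 b2
      push_cast
      linarith [hu.2]
  · intro x y hxy hx k u
    rw [← hx k u]
    have hu := Finset.mem_Icc.mp u.2
    have b1 : (k : ℕ) * R ≤ n * R := Nat.mul_le_mul_right _ (by omega)
    symm
    refine T_local _ _ l R hl hlr β lamr T hT (-i) k i x y ?_ u hu.1 hu.2
    intro v h1 h2
    zify at b1
    refine hxy v (by linarith) ?_
    push_cast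
    linarith
end

section
/- Let p be prime and T_{f[l,r]} the invertible right permutative linear CA over Z_{p²} with local rule f(x_l,...,x_r) = p·Σ_{i=l}^{r-1} β_i x_i + λ_r x_r (mod p²), gcd(p, λ_r) = 1, 0 < l < r. Then the dynamical system (Z_{p²}^Z, B, μ, T_{f[l,r]}) is a Bernoulli automorphism (measure-theoretically isomorphic to a Bernoulli shift). -/
open MeasureTheory
open scoped ENNReal

section helpers

variable {A : Type*} [CommRing A] [Fintype A] [MeasurableSpace A] [DiscreteMeasurableSpace A]

/-- two probability measures agreeing on interval cylinders are equal -/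
lemma ext_cyl (μ ν : Measure (ℤ → A)) [IsProbabilityMeasure μ] [IsProbabilityMeasure ν]
    (h : ∀ (a : ℤ) (s : ℕ) (j : ℕ → A),
      μ {x | ∀ t : ℕ, t ≤ s → x (a + (t : ℤ)) = j t} =
      ν {x | ∀ t : ℕ, t ≤ s → x (a + (t : ℤ)) = j t}) : μ = ν := by
  have key : ∀ k : ℕ, μ.map (Finset.Icc (-(k:ℤ)) k).restrict
      = ν.map (Finset.Icc (-(k:ℤ)) k).restrict := by
    intro k
    refine Measure.ext_of_singleton fun f => ?_
    rw [Measure.map_apply (Finset.measurable_restrict _) (measurableSet_singleton f),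
      Measure.map_apply (Finset.measurable_restrict _) (measurableSet_singleton f)]
    have e : (Finset.Icc (-(k:ℤ)) k).restrict (π := fun _ => A) ⁻¹' {f} =
        {x : ℤ → A | ∀ t : ℕ, t ≤ 2 * k → x (-(k:ℤ) + (t : ℤ)) =
          (fun t : ℕ => if ht : (-(k:ℤ) + (t:ℤ)) ∈ Finset.Icc (-(k:ℤ)) k then f ⟨_, ht⟩ else 0) t} := by
      ext x
      simp only [Set.mem_preimage, Set.mem_singleton_iff, Set.mem_ofPred_eq]
      constructor
      · rintro rfl t ht
        have : (-(k:ℤ) + (t:ℤ)) ∈ Finset.Icc (-(k:ℤ)) k := by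
          rw [Finset.mem_Icc]; omega
        rw [dif_pos this]; rfl
      · intro hx
        ext ⟨i, hi⟩
        have hi' := Finset.mem_Icc.1 hi
        have := hx (i + k).toNat (by omega)
        have e2 : -(k:ℤ) + (((i + k).toNat : ℕ) : ℤ) = i := by omega
        simp only [e2] at this
        rw [dif_pos hi] at this
        exact this
    rw [e]
    exact h _ _ _
  have hP : IsProjectiveLimit μ (fun I : Finset ℤ => ν.map I.restrict) := by
    intro I
    obtain ⟨k, hk⟩ : ∃ k : ℕ, I ⊆ Finset.Icc (-(k:ℤ)) k := by
      refine ⟨∑ i ∈ I, i.natAbs, fun i hi => ?_⟩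
      have := Finset.single_le_sum (f := fun i : ℤ => i.natAbs) (fun _ _ => Nat.zero_le _) hi
      rw [Finset.mem_Icc]
      omega
    have h1 := congrArg (fun m => Measure.map (Finset.restrict₂ (π := fun _ => A) hk) m) (key k)
    rwa [Measure.map_map (Finset.measurable_restrict₂ _) (Finset.measurable_restrict _),
      Measure.map_map (Finset.measurable_restrict₂ _) (Finset.measurable_restrict _),
      Finset.restrict₂_comp_restrict] at h1
  have hP' : IsProjectiveLimit ν (fun I : Finset ℤ => ν.map I.restrict) := fun I => rfl
  have : ∀ I : Finset ℤ, IsFiniteMeasure (ν.map I.restrict) := fun I => inferInstance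
  exact hP.unique hP'

lemma transl (μ : Measure (ℤ → A)) [IsProbabilityMeasure μ] (c : ℕ → ℝ≥0∞)
    (hμ : ∀ (a : ℤ) (s : ℕ) (j : ℕ → A),
      μ {x | ∀ t : ℕ, t ≤ s → x (a + (t : ℤ)) = j t} = c s) (v : ℤ → A) :
    MeasurePreserving (fun x => x + v) μ μ := by
  have hm : Measurable (fun x : ℤ → A => x + v) := by
    refine measurable_pi_lambda _ fun n => ?_
    exact (Measurable.of_discrete (f := fun a : A => a + v n)).comp (measurable_pi_apply n)
  refine ⟨hm, ?_⟩
  have := Measure.isProbabilityMeasure_map (μ := μ) hm.aemeasurable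
  refine ext_cyl _ _ fun a s j => ?_
  rw [hμ, Measure.map_apply hm]
  · rw [← hμ a s (fun t => j t - v (a + t))]
    congr 1
    ext x
    simp [eq_sub_iff_add_eq]
  · simp only [Set.ofPred_forall]
    refine MeasurableSet.iInter fun t => MeasurableSet.iInter fun _ => ?_
    exact (measurable_pi_apply (X := fun _ : ℤ => A) (a + (t:ℤ))) (measurableSet_singleton (j t))

lemma unif {B : Type*} [AddCommGroup B] [Fintype B] [MeasurableSpace B] [DiscreteMeasurableSpace B]
    (μ : Measure (ℤ → A)) [IsProbabilityMeasure μ]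
    (hμ : ∀ v, MeasurePreserving (fun x => x + v) μ μ)
    (F : (ℤ → A) → ℤ → B) (hF : Measurable F) (hadd : ∀ x y, F (x + y) = F x + F y)
    (hsurj : Function.Surjective F) (a : ℤ) (s : ℕ) (j : ℕ → B) :
    μ {x | ∀ t : ℕ, t ≤ s → F x (a + (t : ℤ)) = j t} = ((Fintype.card B : ℝ≥0∞)⁻¹) ^ (s + 1) := by
  classical
  let C : (Fin (s+1) → B) → Set (ℤ → A) := fun J => {x | (fun t : Fin (s+1) => F x (a + (t : ℤ))) = J}
  have hg : Measurable (fun x => (fun t : Fin (s+1) => F x (a + (t : ℤ)))) :=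
    measurable_pi_lambda _ fun t => (measurable_pi_apply _).comp hF
  have hC : ∀ J, MeasurableSet (C J) := fun J => hg (measurableSet_singleton J)
  have hCC : ∀ J, μ (C J) = μ (C 0) := by
    intro J
    obtain ⟨v, hv⟩ := hsurj (fun n => if h : 0 ≤ n - a ∧ n - a < s + 1 then
      J ⟨(n - a).toNat, by omega⟩ else 0)
    rw [← (hμ v).measure_preimage (hC J).nullMeasurableSet]
    congr 1
    ext x
    simp only [C, Set.mem_preimage, Set.mem_ofPred_eq, hadd, hv]
    simp only [funext_iff]
    refine forall_congr' fun t => ?_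
    have ht := t.2
    have : 0 ≤ a + (t:ℤ) - a ∧ a + (t:ℤ) - a < s + 1 := by omega
    simp only [Pi.add_apply, dif_pos this, Pi.zero_apply]
    have e : (⟨(a + (t:ℤ) - a).toNat, by omega⟩ : Fin (s+1)) = t := by
      ext; simp
    rw [e]; simp
  have hsum : ∑ J, μ (C J) = 1 := by
    rw [← measure_biUnion_finset]
    · have : (⋃ J ∈ (Finset.univ : Finset (Fin (s+1) → B)), C J) = Set.univ := by
        ext x; simp [C]
      rw [this, measure_univ]
    · intro J _ K _ hJK
      refine Set.disjoint_left.2 fun x hx hx' => hJK ?_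
      exact hx.symm.trans hx'
    · exact fun J _ => hC J
  have e : {x | ∀ t : ℕ, t ≤ s → F x (a + (t : ℤ)) = j t} = C (fun t => j t) := by
    ext x
    simp only [C, Set.mem_ofPred_eq, funext_iff]
    exact ⟨fun h t => h t (by omega), fun h t ht => h ⟨t, by omega⟩⟩
  rw [e, hCC]
  simp only [hCC, Finset.sum_const, Finset.card_univ, Fintype.card_fun, Fintype.card_fin,
    nsmul_eq_mul] at hsum
  rw [← ENNReal.inv_pow]
  refine ENNReal.eq_inv_of_mul_eq_one_left ?_
  rw [mul_comm]
  exact_mod_cast hsum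

end helpers

section alg

variable {A : Type*} [CommRing A]

/-- the flattened conjugacy -/
noncomputable def GG (π : A) (l r : ℤ) (β : ℤ → A) (w : ℤ → Aˣ) (d : ℤ → A) (x : ℤ → A) (m : ℤ) : A :=
  (w m : A) * x m + d m * (π * ∑ i ∈ Finset.Icc l (r - 1), β i * x (m - r + i))

/-- its inverse -/
noncomputable def HH (π : A) (l r : ℤ) (β : ℤ → A) (w : ℤ → Aˣ) (d : ℤ → A) (y : ℤ → A) (m : ℤ) : A :=
  ((w m)⁻¹ : Aˣ) * (y m - d m * (π * ∑ i ∈ Finset.Icc l (r - 1),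
    β i * (((w (m - r + i))⁻¹ : Aˣ) * y (m - r + i))))

lemma pi_sum {π : A} (l r : ℤ) (β : ℤ → A) (f g : ℤ → A) (h : ∀ i, π * f i = π * g i) :
    π * ∑ i ∈ Finset.Icc l (r - 1), β i * f i = π * ∑ i ∈ Finset.Icc l (r - 1), β i * g i := by
  rw [Finset.mul_sum, Finset.mul_sum]
  refine Finset.sum_congr rfl fun i _ => ?_
  linear_combination β i * h i

lemma HG (π : A) (hπ : π * π = 0) (l r : ℤ) (β : ℤ → A) (w : ℤ → Aˣ) (d : ℤ → A) (x : ℤ → A) :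
    HH π l r β w d (GG π l r β w d x) = x := by
  have h1 : ∀ m, π * (((w m)⁻¹ : Aˣ) * GG π l r β w d x m) = π * x m := by
    intro m
    unfold GG
    have := (w m).inv_mul
    linear_combination π * x m * this + ((w m)⁻¹ : Aˣ) * d m *
      (∑ i ∈ Finset.Icc l (r - 1), β i * x (m - r + i)) * hπ
  funext m
  unfold HH
  rw [pi_sum l r β _ (fun i => x (m - r + i)) (fun i => h1 _)]
  unfold GG
  linear_combination x m * (w m).inv_mul

lemma GH (π : A) (hπ : π * π = 0) (l r : ℤ) (β : ℤ → A) (w : ℤ → Aˣ) (d : ℤ → A) (y : ℤ → A) :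
    GG π l r β w d (HH π l r β w d y) = y := by
  have h1 : ∀ m, π * HH π l r β w d y m = π * (((w m)⁻¹ : Aˣ) * y m) := by
    intro m
    unfold HH
    linear_combination - ((w m)⁻¹ : Aˣ) * d m *
      (∑ i ∈ Finset.Icc l (r - 1), β i * (((w (m - r + i))⁻¹ : Aˣ) * y (m - r + i))) * hπ
  funext m
  unfold GG
  rw [pi_sum l r β _ (fun i => ((w (m - r + i))⁻¹ : Aˣ) * y (m - r + i)) (fun i => h1 _)]
  unfold HH
  linear_combination (y m - d m * (π * ∑ i ∈ Finset.Icc l (r - 1),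
    β i * (((w (m - r + i))⁻¹ : Aˣ) * y (m - r + i)))) * (w m).mul_inv

lemma GG_add (π : A) (l r : ℤ) (β : ℤ → A) (w : ℤ → Aˣ) (d : ℤ → A) (x y : ℤ → A) :
    GG π l r β w d (x + y) = GG π l r β w d x + GG π l r β w d y := by
  funext m
  simp only [GG, Pi.add_apply, mul_add, Finset.sum_add_distrib]
  ring

variable [Countable A] [MeasurableSpace A] [DiscreteMeasurableSpace A]

lemma GG_meas (π : A) (l r : ℤ) (β : ℤ → A) (w : ℤ → Aˣ) (d : ℤ → A) :
    Measurable (GG π l r β w d) := by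
  have : MeasurableMul₂ A := ⟨Measurable.of_discrete⟩
  have : MeasurableAdd₂ A := ⟨Measurable.of_discrete⟩
  refine measurable_pi_lambda _ fun m => ?_
  unfold GG
  fun_prop

lemma HH_meas (π : A) (l r : ℤ) (β : ℤ → A) (w : ℤ → Aˣ) (d : ℤ → A) :
    Measurable (HH π l r β w d) := by
  have : MeasurableMul₂ A := ⟨Measurable.of_discrete⟩
  have : MeasurableAdd₂ A := ⟨Measurable.of_discrete⟩
  have : MeasurableSub₂ A := ⟨Measurable.of_discrete⟩
  refine measurable_pi_lambda _ fun m => ?_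
  unfold HH
  fun_prop

end alg


/-- Let `p` be prime and `T = T_{f[l,r]}` the invertible right permutative linear CA over
`ZMod p²` with local rule `f(x_l,...,x_r) = p·Σ_{i=l}^{r-1} β_i x_i + λ_r x_r (mod p²)`,
`λ_r` a unit, `0 < l < r`, and `μ` the uniform Bernoulli measure. Then the dynamical
system `((ZMod p²)^ℤ, B, μ, T)` is a Bernoulli automorphism: it is measure-theoretically
isomorphic (mod 0) to a Bernoulli shift, i.e. to the shift on `(Fin N)^ℤ` equipped with a
product (Bernoulli) measure `ν` given by a probability vector `q`. -/
theorem stmt17 (p : ℕ) (hp : p.Prime) (l r : ℤ) (hl : 0 < l) (hlr : l < r)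
    (β : ℤ → ZMod (p ^ 2)) (lamr : ZMod (p ^ 2)) (hunit : IsUnit lamr)
    (T : (ℤ → ZMod (p ^ 2)) → ℤ → ZMod (p ^ 2))
    (hT : ∀ x n, T x n =
      (p : ZMod (p ^ 2)) * ∑ i ∈ Finset.Icc l (r - 1), β i * x (n + i) + lamr * x (n + r))
    (hbij : Function.Bijective T)
    (μ : Measure (ℤ → ZMod (p ^ 2))) [IsProbabilityMeasure μ]
    (hμ : ∀ (a : ℤ) (s : ℕ) (j : ℕ → ZMod (p ^ 2)),
      μ {x | ∀ t : ℕ, t ≤ s → x (a + (t : ℤ)) = j t} = (((p ^ 2 : ℕ) : ℝ≥0∞))⁻¹ ^ (s + 1)) :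
    ∃ (N : ℕ) (_ : 0 < N) (q : Fin N → ℝ≥0∞) (_ : ∑ a : Fin N, q a = 1)
      (ν : Measure (ℤ → Fin N)) (_ : IsProbabilityMeasure ν)
      (_ : ∀ (a : ℤ) (s : ℕ) (j : ℕ → Fin N),
        ν {y | ∀ t : ℕ, t ≤ s → y (a + (t : ℤ)) = j t} = ∏ t ∈ Finset.range (s + 1), q (j t))
      (φ : (ℤ → ZMod (p ^ 2)) → ℤ → Fin N) (ψ : (ℤ → Fin N) → ℤ → ZMod (p ^ 2)),
      MeasurePreserving φ μ ν ∧ MeasurePreserving ψ ν μ ∧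
      (∀ᵐ x ∂μ, ψ (φ x) = x) ∧ (∀ᵐ y ∂ν, φ (ψ y) = y) ∧
      (∀ᵐ x ∂μ, φ (T x) = fun n => φ x (n + 1)) := by
  classical
  obtain ⟨u, rfl⟩ := hunit
  have hr : 0 < r := hl.trans hlr
  have : NeZero (p ^ 2) := ⟨pow_ne_zero _ hp.ne_zero⟩
  have : DiscreteMeasurableSpace (ZMod (p ^ 2)) := ⟨fun _ => trivial⟩
  have hπ : (p : ZMod (p ^ 2)) * p = 0 := by
    rw [← pow_two]; exact_mod_cast ZMod.natCast_self (p ^ 2)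
  let w : ℤ → (ZMod (p ^ 2))ˣ := fun m => u ^ (m / r)
  let d : ℤ → ZMod (p ^ 2) := fun m => ((m / r : ℤ) : ZMod (p ^ 2)) * ((u ^ (m / r - 1) : (ZMod (p ^ 2))ˣ) : ZMod (p ^ 2))
  let G := GG (p : ZMod (p ^ 2)) l r β w d
  let H := HH (p : ZMod (p ^ 2)) l r β w d
  let B := (Finset.Ico (0 : ℤ) r) → ZMod (p ^ 2)
  let F : (ℤ → ZMod (p ^ 2)) → ℤ → B := fun x n j => G x (n * r + j)
  let K : (ℤ → B) → ℤ → ZMod (p ^ 2) := fun y => H fun m =>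
    y (m / r) ⟨m % r, Finset.mem_Ico.2 ⟨Int.emod_nonneg _ hr.ne', Int.emod_lt_of_pos _ hr⟩⟩
  have hGm : Measurable G := GG_meas _ _ _ _ _ _
  have hHm : Measurable H := HH_meas _ _ _ _ _ _
  have hFm : Measurable F := by
    refine measurable_pi_lambda _ fun n => measurable_pi_lambda _ fun j => ?_
    exact (measurable_pi_apply _).comp hGm
  have hKm : Measurable K := by
    refine hHm.comp (measurable_pi_lambda _ fun m => ?_)
    exact (measurable_pi_apply _).comp (measurable_pi_apply _)
  have hKF : ∀ x, K (F x) = x := by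
    intro x
    have : (fun m : ℤ => G x (m / r * r + m % r)) = G x := by
      funext m
      rw [mul_comm, Int.mul_ediv_add_emod]
    change H (fun m : ℤ => G x (m / r * r + m % r)) = x
    rw [this]
    exact HG _ hπ _ _ _ _ _ _
  have hdiv : ∀ n j : ℤ, 0 ≤ j → j < r → (n * r + j) / r = n := by
    intro n j h0 h1
    rw [add_comm, Int.add_mul_ediv_right _ _ hr.ne', Int.ediv_eq_zero_of_lt h0 h1, zero_add]
  have hmod : ∀ n j : ℤ, 0 ≤ j → j < r → (n * r + j) % r = j := by
    intro n j h0 h1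
    rw [add_comm, Int.add_mul_emod_self_right, Int.emod_eq_of_lt h0 h1]
  have hFK : ∀ y, F (K y) = y := by
    intro y
    funext n ⟨j, hj⟩
    obtain ⟨h0, h1⟩ := Finset.mem_Ico.1 hj
    change GG _ l r β w d (HH _ l r β w d _) (n * r + j) = _
    rw [GH _ hπ]
    simp only [hdiv n j h0 h1, hmod n j h0 h1]
  have hFadd : ∀ x y, F (x + y) = F x + F y := by
    intro x y
    funext n j
    exact congrFun (GG_add (p : ZMod (p ^ 2)) l r β w d x y) _
  have hFT : ∀ x n, F (T x) n = F x (n + 1) := by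
    intro x n
    funext ⟨j, hj⟩
    obtain ⟨h0, h1⟩ := Finset.mem_Ico.1 hj
    change GG _ l r β w d (T x) (n * r + j) = GG _ l r β w d x ((n + 1) * r + j)
    have hpT : ∀ m, (p : ZMod (p ^ 2)) * T x m = p * (u * x (m + r)) := by
      intro m
      rw [hT]
      linear_combination (∑ i ∈ Finset.Icc l (r - 1), β i * x (m + i)) * hπ
    unfold GG
    rw [pi_sum l r β _ (fun i => u * x (n * r + j - r + i + r)) (fun i => hpT _), hT]
    simp only [w, d, hdiv n j h0 h1, hdiv (n + 1) j h0 h1]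
    have e1 : ∀ i, n * r + j - r + i + r = n * r + j + i := fun i => by ring
    have e2 : ∀ i, (n + 1) * r + j - r + i = n * r + j + i := fun i => by ring
    have e3 : n * r + j + r = (n + 1) * r + j := by ring
    have e4 : ∑ i ∈ Finset.Icc l (r - 1), β i * ((u : ZMod (p ^ 2)) * x (n * r + j + i)) =
        u * ∑ i ∈ Finset.Icc l (r - 1), β i * x (n * r + j + i) := by
      rw [Finset.mul_sum]
      exact Finset.sum_congr rfl fun i _ => by ring
    simp only [e1, e2, e3, e4, add_sub_cancel_right]
    have e5 : ((u ^ (n + 1) : (ZMod (p ^ 2))ˣ) : ZMod (p ^ 2)) = ((u ^ n : (ZMod (p ^ 2))ˣ) : ZMod (p ^ 2)) * u := by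
      rw [zpow_add_one, Units.val_mul]
    have e6 : ((u ^ n : (ZMod (p ^ 2))ˣ) : ZMod (p ^ 2)) = ((u ^ (n - 1) : (ZMod (p ^ 2))ˣ) : ZMod (p ^ 2)) * u := by
      rw [← Units.val_mul, ← zpow_add_one, sub_add_cancel]
    rw [e5, e6]
    push_cast
    ring
  have hcyl := unif μ (transl μ _ hμ) F hFm hFadd (fun y => ⟨K y, hFK y⟩)
  let e : B ≃ Fin (Fintype.card B) := Fintype.equivFin B
  let φ : (ℤ → ZMod (p ^ 2)) → ℤ → Fin (Fintype.card B) := fun x n => e (F x n)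
  let ψ : (ℤ → Fin (Fintype.card B)) → ℤ → ZMod (p ^ 2) := fun y => K fun n => e.symm (y n)
  have hφ : Measurable φ := measurable_pi_lambda _ fun n =>
    (Measurable.of_discrete (f := e)).comp ((measurable_pi_apply n).comp hFm)
  have hψ : Measurable ψ := hKm.comp (measurable_pi_lambda _ fun n =>
    (Measurable.of_discrete (f := e.symm)).comp (measurable_pi_apply n))
  have hψφ : ∀ x, ψ (φ x) = x := fun x => by
    simp only [ψ, φ, Equiv.symm_apply_apply]; exact hKF x
  have hφψ : ∀ y, φ (ψ y) = y := fun y => by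
    simp only [ψ, φ, hFK, Equiv.apply_symm_apply]
  have hB : Fintype.card B ≠ 0 := Fintype.card_ne_zero
  refine ⟨Fintype.card B, Nat.pos_of_ne_zero hB, fun _ => (Fintype.card B : ℝ≥0∞)⁻¹, ?_,
    μ.map φ, Measure.isProbabilityMeasure_map hφ.aemeasurable, ?_, φ, ψ, ⟨hφ, rfl⟩, ⟨hψ, ?_⟩,
    ae_of_all _ hψφ, ae_of_all _ hφψ, ae_of_all _ fun x => ?_⟩
  · rw [Finset.sum_const, Finset.card_univ, Fintype.card_fin, nsmul_eq_mul]
    exact ENNReal.mul_inv_cancel (by exact_mod_cast hB) (ENNReal.natCast_ne_top _)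
  · intro a s j
    rw [Measure.map_apply hφ, Finset.prod_const, Finset.card_range,
      ← hcyl a s (fun t => e.symm (j t))]
    · congr 1
      ext x
      simp only [φ, Set.mem_preimage, Set.mem_ofPred_eq, Equiv.eq_symm_apply]
    · simp only [Set.ofPred_forall]
      refine MeasurableSet.iInter fun t => MeasurableSet.iInter fun _ => ?_
      exact (measurable_pi_apply (X := fun _ : ℤ => Fin (Fintype.card B)) (a + (t:ℤ))) (measurableSet_singleton (j t))
  · rw [Measure.map_map hψ hφ]
    have : ψ ∘ φ = id := funext hψφ
    rw [this, Measure.map_id]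
  · funext n
    simp only [φ, hFT]
end
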